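/- Let R be a ring and A a left R-module such that Ext^i_R(G, A) = 0 for every Gorenstein projective left R-module G and every i ≥ 1. Then pd_R A = SGfd_R A = Gpd_R A, i.e. the projective dimension, the strongly Gorenstein flat dimension, and the Gorenstein projective dimension of A coincide. -/

import Mathlib

open CategoryTheory CategoryTheory.Limits CategoryTheory.Abelian ZeroObject

universe w v u

namespace RelHomDim

variable {𝒜 : Type u} [Category.{v} 𝒜] [Abelian 𝒜]

/-- A class of objects of an abelian category corresponding to a full additive
subcategory: it is closed under isomorphisms, contains a zero object and is
closed under finite direct sums (biproducts). -/
def IsAdditiveClass (P : 𝒜 → Prop) : Prop :=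
  P 0 ∧ (∀ ⦃X Y : 𝒜⦄, (X ≅ Y) → P X → P Y) ∧ ∀ ⦃X Y : 𝒜⦄, P X → P Y → P (X ⊞ Y)

/-- A class of objects is closed under direct summands. -/
def ClosedUnderSummands (P : 𝒜 → Prop) : Prop :=
  ∀ X Y : 𝒜, P (X ⊞ Y) → P X ∧ P Y

/-- `Hom(W,-)`-exactness of a short exact sequence `0 → X₁ → X₂ → X₃ → 0`:
the induced sequence `0 → Hom(W,X₁) → Hom(W,X₂) → Hom(W,X₃) → 0` is exact. -/
def CovHomExact (W : 𝒜) (S : ShortComplex 𝒜) : Prop :=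
  (∀ a b : W ⟶ S.X₁, a ≫ S.f = b ≫ S.f → a = b) ∧
  (∀ b : W ⟶ S.X₂, b ≫ S.g = 0 → ∃ a : W ⟶ S.X₁, a ≫ S.f = b) ∧
  (∀ c : W ⟶ S.X₃, ∃ b : W ⟶ S.X₂, b ≫ S.g = c)

/-- A short exact sequence is `ℰ`-proper (i.e. `Hom(ℰ,-)`-exact) if it is
`Hom(E,-)`-exact for every object `E` in the class `ℰ`. -/
def EProper (E : 𝒜 → Prop) (S : ShortComplex 𝒜) : Prop :=
  ∀ W, E W → CovHomExact W S

/-- `ResW P W n K A` holds iff there is an exact sequence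
`0 → K → X_{n-1} → ⋯ → X_0 → A → 0` in `𝒜` with all the `n` middle terms `X i`
in `P`, such that each of the short exact sequences obtained by splicing
satisfies `W` (this encodes, e.g., `Hom(ℰ,-)`-exactness of the whole sequence). -/
def ResW (P : 𝒜 → Prop) (W : ShortComplex 𝒜 → Prop) : ℕ → 𝒜 → 𝒜 → Prop
  | 0 => fun K A => Nonempty (K ≅ A)
  | n + 1 => fun K A => ∃ (B X : 𝒜) (f : B ⟶ X) (g : X ⟶ A) (w : f ≫ g = 0),
      P X ∧ (ShortComplex.mk f g w).ShortExact ∧ W (ShortComplex.mk f g w) ∧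
      ResW P W n K B

/-- `Res P n K A` : there is an exact sequence `0 → K → X_{n-1} → ⋯ → X_0 → A → 0`
with all middle terms in `P`. -/
abbrev Res (P : 𝒜 → Prop) : ℕ → 𝒜 → 𝒜 → Prop := ResW P fun _ => True

/-- `CoresW P W n A K` holds iff there is an exact sequence
`0 → A → X^0 → ⋯ → X^{n-1} → K → 0` with all middle terms in `P` and each
spliced short exact piece satisfying `W`. -/
def CoresW (P : 𝒜 → Prop) (W : ShortComplex 𝒜 → Prop) : ℕ → 𝒜 → 𝒜 → Prop
  | 0 => fun A K => Nonempty (A ≅ K)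
  | n + 1 => fun A K => ∃ (X B : 𝒜) (f : A ⟶ X) (g : X ⟶ B) (w : f ≫ g = 0),
      P X ∧ (ShortComplex.mk f g w).ShortExact ∧ W (ShortComplex.mk f g w) ∧
      CoresW P W n B K

/-- `Cores P n A K` : there is an exact sequence `0 → A → X^0 → ⋯ → X^{n-1} → K → 0`
with all middle terms in `P`. -/
abbrev Cores (P : 𝒜 → Prop) : ℕ → 𝒜 → 𝒜 → Prop := CoresW P fun _ => True

/-- The `P`-dimension of `A` : the infimum of the `n ≥ 0` such that there is
an exact sequence `0 → C_n → ⋯ → C_1 → C_0 → A → 0` with all `C_i` in `P`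
(`⊤ = ∞` if there is no such `n`). -/
noncomputable def rdim (P : 𝒜 → Prop) (A : 𝒜) : ℕ∞ :=
  sInf {c : ℕ∞ | ∃ n : ℕ, c = n ∧ ∃ K, P K ∧ Res P n K A}

/-- The `P`-codimension of `A` : the infimum of the `n ≥ 0` such that there is
an exact sequence `0 → A → C^0 → C^1 → ⋯ → C^n → 0` with all `C^i` in `P`
(`⊤ = ∞` if there is no such `n`). -/
noncomputable def rcodim (P : 𝒜 → Prop) (A : 𝒜) : ℕ∞ :=
  sInf {c : ℕ∞ | ∃ n : ℕ, c = n ∧ ∃ K, P K ∧ Cores P n A K}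

/-- `A` belongs to `P^⊥`, i.e. `Ext^i(C, A) = 0` for all `C` in `P` and `i ≥ 1`. -/
def MemRightPerp [HasExt.{w} 𝒜] (P : 𝒜 → Prop) (A : 𝒜) : Prop :=
  ∀ C, P C → ∀ i : ℕ, 1 ≤ i → Subsingleton (Abelian.Ext C A i)

/-- `A` belongs to `^⊥P`, i.e. `Ext^i(A, C) = 0` for all `C` in `P` and `i ≥ 1`. -/
def MemLeftPerp [HasExt.{w} 𝒜] (P : 𝒜 → Prop) (A : 𝒜) : Prop :=
  ∀ C, P C → ∀ i : ℕ, 1 ≤ i → Subsingleton (Abelian.Ext A C i)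

/-- `𝒞` is an `ℰ`-proper generator for `𝒯` (`𝒞 ⊆ 𝒯` and every object of `𝒯`
is an `ℰ`-proper quotient of an object of `𝒞` with kernel in `𝒯`). -/
def IsProperGenerator (E C T : 𝒜 → Prop) : Prop :=
  (∀ ⦃X⦄, C X → T X) ∧
  ∀ X, T X → ∃ (X' Cb : 𝒜) (f : X' ⟶ Cb) (g : Cb ⟶ X) (w : f ≫ g = 0),
    C Cb ∧ T X' ∧ (ShortComplex.mk f g w).ShortExact ∧ EProper E (ShortComplex.mk f g w)

/-- `𝒞` is a cogenerator for `𝒯`. -/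
def IsCogenerator (C T : 𝒜 → Prop) : Prop :=
  (∀ ⦃X⦄, C X → T X) ∧
  ∀ X, T X → ∃ (Cb X' : 𝒜) (f : X ⟶ Cb) (g : Cb ⟶ X') (w : f ≫ g = 0),
    C Cb ∧ T X' ∧ (ShortComplex.mk f g w).ShortExact

/-- `𝒯` is closed under `ℰ`-proper extensions. -/
def ClosedUnderProperExtensions (E T : 𝒜 → Prop) : Prop :=
  ∀ S : ShortComplex 𝒜, S.ShortExact → EProper E S → T S.X₁ → T S.X₃ → T S.X₂

/-- `𝒯` is closed under kernels of `ℰ`-proper epimorphisms. -/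
def ClosedUnderProperKernels (E T : 𝒜 → Prop) : Prop :=
  ∀ S : ShortComplex 𝒜, S.ShortExact → EProper E S → T S.X₂ → T S.X₃ → T S.X₁

/-- `𝒯` is an `ℰ`-preresolving subcategory with `ℰ`-proper generator `𝒞`. -/
def IsPreresolving (E T C : 𝒜 → Prop) : Prop :=
  IsProperGenerator E C T ∧ ClosedUnderProperExtensions E T


/-- Exactness of a four-term sequence `0 → M → T₁ → T₀ → A → 0`. -/
def FourTermExact {M T1 T0 A : 𝒜} (f : M ⟶ T1) (g : T1 ⟶ T0) (h : T0 ⟶ A) : Prop :=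
  Mono f ∧ Epi h ∧ ∃ (w₁ : f ≫ g = 0) (w₂ : g ≫ h = 0),
    (ShortComplex.mk f g w₁).Exact ∧ (ShortComplex.mk g h w₂).Exact

/-- `Hom(W,-)`-exactness of the four-term exact sequence `0 → M → T₁ → T₀ → A → 0` :
the induced sequence `0 → Hom(W,M) → Hom(W,T₁) → Hom(W,T₀) → Hom(W,A) → 0` is exact. -/
def CovHomExact4 (W : 𝒜) {M T1 T0 A : 𝒜} (f : M ⟶ T1) (g : T1 ⟶ T0) (h : T0 ⟶ A) : Prop :=
  (∀ a b : W ⟶ M, a ≫ f = b ≫ f → a = b) ∧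
  (∀ b : W ⟶ T1, b ≫ g = 0 → ∃ a : W ⟶ M, a ≫ f = b) ∧
  (∀ c : W ⟶ T0, c ≫ h = 0 → ∃ b : W ⟶ T1, b ≫ g = c) ∧
  (∀ d : W ⟶ A, ∃ c : W ⟶ T0, c ≫ h = d)

/-- There is an exact sequence `0 → M → K⁰ → C¹ → ⋯ → Cⁿ → 0` with `K⁰` in `T`
and all `C^i` in `C`. -/
def MixedCores (T C : 𝒜 → Prop) : ℕ → 𝒜 → Prop
  | 0 => fun M => ∃ K, T K ∧ Nonempty (M ≅ K)
  | n + 1 => fun M => ∃ (K H : 𝒜) (f : M ⟶ K) (g : K ⟶ H) (w : f ≫ g = 0),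
      T K ∧ (ShortComplex.mk f g w).ShortExact ∧ ∃ K', C K' ∧ Cores C n H K'

/-- The Gorenstein subcategory `𝒢(𝒞)` : objects `A` admitting a doubly infinite
exact sequence `⋯ → X_{-1} → X_0 → X_1 → ⋯` with all terms in `𝒞`, which is both
`Hom(𝒞,-)`-exact and `Hom(-,𝒞)`-exact, such that `A ≅ Im(X_0 → X_1)`. -/
def IsGorenstein (P : 𝒜 → Prop) (A : 𝒜) : Prop :=
  ∃ (X : ℤ → 𝒜) (d : ∀ i : ℤ, X i ⟶ X (i + 1)) (w : ∀ i, d i ≫ d (i + 1) = 0),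
    (∀ i, P (X i)) ∧
    (∀ i, (ShortComplex.mk (d i) (d (i + 1)) (w i)).Exact) ∧
    (∀ C, P C → ∀ (i : ℤ) (f : C ⟶ X (i + 1)), f ≫ d (i + 1) = 0 →
      ∃ g : C ⟶ X i, g ≫ d i = f) ∧
    (∀ C, P C → ∀ (i : ℤ) (f : X (i + 1) ⟶ C), d i ≫ f = 0 →
      ∃ g : X (i + 1 + 1) ⟶ C, d (i + 1) ≫ g = f) ∧
    Nonempty (A ≅ Limits.image (d 0))


section Modules

variable (R : Type u) [Ring R]

/-- `G` is isomorphic to the image of the middle map of a doubly infinite exact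
sequence of projective `R`-modules which stays exact under `Hom(-, F)` for every
module `F` satisfying `Q`. -/
def IsTotallyAcyclicImageFor (Q : ModuleCat.{u} R → Prop) (G : ModuleCat.{u} R) : Prop :=
  ∃ (X : ℤ → ModuleCat.{u} R) (d : ∀ i : ℤ, X i ⟶ X (i + 1)) (w : ∀ i, d i ≫ d (i + 1) = 0),
    (∀ i, Projective (X i)) ∧
    (∀ i, (ShortComplex.mk (d i) (d (i + 1)) (w i)).Exact) ∧
    (∀ F, Q F → ∀ (i : ℤ) (f : X (i + 1) ⟶ F), d i ≫ f = 0 →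
      ∃ g : X (i + 1 + 1) ⟶ F, d (i + 1) ≫ g = f) ∧
    Nonempty (G ≅ Limits.image (d 0))

/-- Gorenstein projective modules. -/
def IsGorensteinProjective (G : ModuleCat.{u} R) : Prop :=
  IsTotallyAcyclicImageFor R (fun Q => Projective Q) G

/-- Flatness of a left module over an arbitrary ring, via the Lazard–Govorov
characterization: a module is flat iff every homomorphism from a finitely
presented module to it factors through a finitely generated free module. -/
def IsFlatModule (F : ModuleCat.{u} R) : Prop :=
  ∀ (P : ModuleCat.{u} R), Module.FinitePresentation R P → ∀ f : P ⟶ F,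
    ∃ (n : ℕ) (g : P ⟶ ModuleCat.of R (Fin n → R)) (h : ModuleCat.of R (Fin n → R) ⟶ F),
      g ≫ h = f

/-- Strongly Gorenstein flat modules. -/
def IsStronglyGorensteinFlat (G : ModuleCat.{u} R) : Prop :=
  IsTotallyAcyclicImageFor R (fun F => IsFlatModule R F) G

end Modules

end RelHomDim

namespace RelHomDim

section Abelian

variable {𝒜 : Type u} [Category.{v} 𝒜] [Abelian 𝒜]

lemma rdim_le_rdim {P Q : 𝒜 → Prop} {A : 𝒜}
    (h : ∀ n K, Q K → Res Q n K A → ∃ K', P K' ∧ Res P n K' A) : rdim P A ≤ rdim Q A := by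
  refine sInf_le_sInf ?_
  rintro c ⟨n, hc, K, hK, hres⟩
  exact ⟨n, hc, h n K hK hres⟩

lemma ResW.mono {P Q : 𝒜 → Prop} {W : ShortComplex 𝒜 → Prop} (h : ∀ X, Q X → P X) :
    ∀ (n : ℕ) {K A : 𝒜}, ResW Q W n K A → ResW P W n K A
  | 0, _, _, hr => hr
  | n + 1, _, _, ⟨B, X, f, g, w, hX, hS, hW, hr⟩ =>
    ⟨B, X, f, g, w, h X hX, hS, hW, ResW.mono h n hr⟩

lemma rdim_anti {P Q : 𝒜 → Prop} (h : ∀ X, Q X → P X) (A : 𝒜) : rdim P A ≤ rdim Q A :=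
  rdim_le_rdim fun n K hK hr => ⟨K, h K hK, ResW.mono h n hr⟩

/-- The image factorizations of two composable morphisms, exact in the middle, form a short
exact sequence. -/
lemma shortExact_image {X Y Z : 𝒜} {a : X ⟶ Y} {b : Y ⟶ Z} {w : a ≫ b = 0}
    (h : (ShortComplex.mk a b w).Exact) :
    ∃ w', (ShortComplex.mk (Limits.image.ι a) (factorThruImage b) w').ShortExact := by
  have w' : Limits.image.ι a ≫ factorThruImage b = 0 := by
    rw [← cancel_epi (factorThruImage a), ← cancel_mono (Limits.image.ι b)]
    simpa using w
  refine ⟨w', ShortComplex.ShortExact.mk ?_⟩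
  let φ : ShortComplex.mk a b w ⟶ ShortComplex.mk (Limits.image.ι a) b
      (by rw [← Limits.image.fac b, reassoc_of% w', zero_comp]) :=
    { τ₁ := factorThruImage a, τ₂ := 𝟙 _, τ₃ := 𝟙 _ }
  let ψ : ShortComplex.mk (Limits.image.ι a) (factorThruImage b) w' ⟶ ShortComplex.mk (Limits.image.ι a) b
      (by rw [← Limits.image.fac b, reassoc_of% w', zero_comp]) :=
    { τ₁ := 𝟙 _, τ₂ := 𝟙 _, τ₃ := Limits.image.ι b }
  have : Epi φ.τ₁ := inferInstanceAs (Epi (factorThruImage a))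
  have : IsIso φ.τ₂ := inferInstanceAs (IsIso (𝟙 _))
  have : Mono φ.τ₃ := inferInstanceAs (Mono (𝟙 _))
  have : Epi ψ.τ₁ := inferInstanceAs (Epi (𝟙 _))
  have : IsIso ψ.τ₂ := inferInstanceAs (IsIso (𝟙 _))
  have : Mono ψ.τ₃ := inferInstanceAs (Mono (Limits.image.ι b))
  exact (ShortComplex.exact_iff_of_epi_of_isIso_of_mono ψ).2
    ((ShortComplex.exact_iff_of_epi_of_isIso_of_mono φ).1 h)

lemma exists_extension_of_subsingleton_ext [HasExt.{w} 𝒜] {S : ShortComplex 𝒜}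
    (hS : S.ShortExact) {A : 𝒜} (h : Subsingleton (Abelian.Ext S.X₃ A 1)) (f : S.X₁ ⟶ A) :
    ∃ g : S.X₂ ⟶ A, S.f ≫ g = f := by
  obtain ⟨x, hx⟩ := Abelian.Ext.contravariant_sequence_exact₁ hS A (Abelian.Ext.mk₀ f)
    (add_zero 1) (Subsingleton.elim _ _)
  obtain ⟨g, rfl⟩ := (Abelian.Ext.mk₀_bijective _ _).2 x
  rw [Abelian.Ext.mk₀_comp_mk₀] at hx
  exact ⟨g, (Abelian.Ext.mk₀_bijective _ _).1 hx⟩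

/-- Suppose that the identity of `A` is, modulo a morphism factoring through a projective
object `P`, a composition `A ⟶ M ⟶ A`, and that `M ⟶ A` extends, along an epimorphism
`g : G ⟶ M`, to a projective object `P₀` containing `G`. Then `A` is the cokernel of
a monomorphism `k : K ⟶ Q` with `Q` projective, and the identity of `K` factors through
`ker g` modulo a morphism factoring through a projective object. -/
lemma exists_syzygy {A M B G P P₀ : 𝒜} [Projective P] [Projective P₀] {f : B ⟶ G} {g : G ⟶ M}
    {w : f ≫ g = 0} (hS : (ShortComplex.mk f g w).ShortExact)
    {i : A ⟶ M} {p : M ⟶ A} {j : A ⟶ P} {q : P ⟶ A} (hid : i ≫ p + j ≫ q = 𝟙 A)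
    {e : G ⟶ P₀} {r : P₀ ⟶ A} (her : e ≫ r = g ≫ p) :
    ∃ (K Q : 𝒜) (k : K ⟶ Q) (π : Q ⟶ A) (w : k ≫ π = 0), Projective Q ∧
      (ShortComplex.mk k π w).ShortExact ∧
      ∃ (i' : K ⟶ B) (p' : B ⟶ K) (j' : K ⟶ Q) (q' : Q ⟶ K), i' ≫ p' + j' ≫ q' = 𝟙 K := by
  have : Epi g := hS.epi_g
  have : Mono f := hS.mono_f
  let π : P₀ ⊞ P ⟶ A := biprod.desc r q
  have : Epi π := by
    refine Preadditive.epi_of_cancel_zero _ fun x hx => ?_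
    have hr : r ≫ x = 0 := by simpa [π] using biprod.inl ≫= hx
    have hq : q ≫ x = 0 := by simpa [π] using biprod.inr ≫= hx
    have hp : p ≫ x = 0 := by
      rw [← cancel_epi g, ← reassoc_of% her, hr]
      simp
    rw [← Category.id_comp x, ← hid]
    simp [hp, hq]
  let s : P₀ ⊞ P ⟶ G := Projective.factorThru (π ≫ i) g
  have hs : s ≫ g = π ≫ i := Projective.factorThru_comp _ _
  let θ : P₀ ⊞ P ⟶ P₀ ⊞ P := s ≫ e ≫ biprod.inl + π ≫ j ≫ biprod.inr
  have hθ : θ ≫ π = π := by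
    have : θ ≫ π = π ≫ (i ≫ p + j ≫ q) := by
      simp [θ, π, her, reassoc_of% hs]
    rw [this, hid, Category.comp_id]
  let b : kernel π ⟶ B := hS.exact.lift (kernel.ι π ≫ s) (by simp [hs])
  have hb : b ≫ f = kernel.ι π ≫ s := hS.exact.lift_f _ _
  let c : B ⟶ kernel π := kernel.lift π (f ≫ e ≫ biprod.inl) (by simp [π, her, reassoc_of% w])
  let δ : P₀ ⊞ P ⟶ kernel π := kernel.lift π (𝟙 _ - θ) (by simp [hθ])
  refine ⟨kernel π, P₀ ⊞ P, kernel.ι π, π, kernel.condition π, inferInstance,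
    { exact := ShortComplex.exact_kernel π }, b, c, kernel.ι π, δ, ?_⟩
  rw [← cancel_mono (kernel.ι π)]
  simp [c, δ, θ, reassoc_of% hb]

end Abelian

section Modules

variable {R : Type u} [Ring R]

lemma isFlatModule_of_projective {F : ModuleCat.{u} R} (hF : Projective F) :
    IsFlatModule R F := by
  intro P hP f
  have hF' : Module.Projective R F := (IsProjective.iff_projective F).2 hF
  obtain ⟨s, hs⟩ := Module.projective_def'.1 hF'
  obtain ⟨t, ht⟩ := (Module.Finite.fg_top : (⊤ : Submodule R P).FG)
  classical
  let S : Finset F := t.biUnion fun x => (s (f x)).support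
  let e := S.equivFin
  refine ⟨S.card, ModuleCat.ofHom (LinearMap.pi fun k =>
      Finsupp.lapply (e.symm k : F) ∘ₗ s ∘ₗ f.hom),
    ModuleCat.ofHom (Fintype.linearCombination R fun k => (e.symm k : F)), ?_⟩
  ext : 1
  refine LinearMap.ext_on ht fun x hx => ?_
  have hsub : (s (f x)).support ⊆ S :=
    Finset.subset_biUnion_of_mem (fun x => (s (f x)).support) hx
  have h1 : Finsupp.linearCombination R id (s (f x)) = f x := LinearMap.congr_fun hs (f x)
  rw [Finsupp.linearCombination_apply, Finsupp.sum_of_support_subset _ hsub _ (by simp)] at h1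
  refine Eq.trans ?_ h1
  rw [← Finset.sum_coe_sort S]
  exact Fintype.sum_equiv e.symm _ _ fun k => rfl

lemma IsStronglyGorensteinFlat.isGorensteinProjective {G : ModuleCat.{u} R}
    (h : IsStronglyGorensteinFlat R G) : IsGorensteinProjective R G := by
  obtain ⟨X, d, w, hX, hE, hQ, hG⟩ := h
  exact ⟨X, d, w, hX, hE, fun F hF => hQ F (isFlatModule_of_projective hF), hG⟩

lemma isTotallyAcyclicImageFor_of_projective (Q : ModuleCat.{u} R → Prop) {P : ModuleCat.{u} R}
    (hP : Projective P) : IsTotallyAcyclicImageFor R Q P := by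
  refine ⟨fun _ => P ⊞ P, fun _ => biprod.snd ≫ biprod.inl, fun _ => by simp,
    fun _ => inferInstance, fun _ => ?_, fun F _ _ f hf => ⟨biprod.desc (biprod.inr ≫ f) 0, ?_⟩,
    ⟨image.isoStrongEpiMono biprod.snd biprod.inl rfl⟩⟩
  · rw [ShortComplex.exact_iff_exact_up_to_refinements]
    intro T x hx
    refine ⟨T, 𝟙 T, inferInstance, x ≫ biprod.fst ≫ biprod.inr, ?_⟩
    have hx' : x ≫ (biprod.snd : P ⊞ P ⟶ P) = 0 := by
      rw [← cancel_mono (biprod.inl : P ⟶ P ⊞ P)]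
      simpa using hx
    apply biprod.hom_ext <;> simp [hx']
  · have hf' : (biprod.inl : P ⟶ P ⊞ P) ≫ f = 0 := by
      rw [← cancel_epi (biprod.snd : P ⊞ P ⟶ P)]
      simpa using hf
    apply biprod.hom_ext' <;> simp [hf']

/-- Every boundary object of a totally acyclic complex is the middle one of a shifted complex. -/
lemma isTotallyAcyclicImageFor_image {Q : ModuleCat.{u} R → Prop} {X : ℤ → ModuleCat.{u} R}
    {d : ∀ i : ℤ, X i ⟶ X (i + 1)} (w : ∀ i, d i ≫ d (i + 1) = 0)
    (hX : ∀ i, Projective (X i))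
    (hE : ∀ i, (ShortComplex.mk (d i) (d (i + 1)) (w i)).Exact)
    (hQ : ∀ F, Q F → ∀ (i : ℤ) (f : X (i + 1) ⟶ F), d i ≫ f = 0 →
      ∃ g : X (i + 1 + 1) ⟶ F, d (i + 1) ≫ g = f) (c : ℤ) :
    IsTotallyAcyclicImageFor R Q (image (d c)) := by
  let D (a b : ℤ) (h : a + 1 = b) : X a ⟶ X b := d a ≫ eqToHom (by rw [h])
  have hD (a : ℤ) : D a (a + 1) rfl = d a := by simp [D]
  have hw (a b c : ℤ) (h : a + 1 = b) (h' : b + 1 = c) : D a b h ≫ D b c h' = 0 := by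
    subst h h'
    simp only [hD, w]
  have hc (k : ℤ) : k + c + 1 = k + 1 + c := by ring
  refine ⟨fun k => X (k + c), fun k => D (k + c) (k + 1 + c) (hc k),
    fun k => hw _ _ _ (hc k) (hc (k + 1)),
    fun k => hX _, fun k => ?_, fun F hF k => ?_, ?_⟩
  · have (a b c : ℤ) (h : a + 1 = b) (h' : b + 1 = c) :
        (ShortComplex.mk (D a b h) (D b c h') (hw _ _ _ h h')).Exact := by
      subst h h'
      simpa only [hD] using hE a
    exact this _ _ _ (hc k) (hc (k + 1))
  · have (a b c : ℤ) (h : a + 1 = b) (h' : b + 1 = c) (f : X b ⟶ F) (hf : D a b h ≫ f = 0) :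
        ∃ g : X c ⟶ F, D b c h' ≫ g = f := by
      subst h h'
      simp only [hD] at hf ⊢
      exact hQ F hF a f hf
    exact this _ _ _ (hc k) (hc (k + 1))
  · have (a b : ℤ) (h : a + 1 = b) (hca : c = a) :
        Nonempty (image (d c) ≅ image (D a b h)) := by
      subst hca h
      exact ⟨image.eqToIso (hD c).symm⟩
    exact this _ _ (hc 0) (zero_add c).symm

variable (R) in
/-- The functor `Hom(-, A)` preserves exactness of all totally acyclic complexes of projectives. -/
def IsTotallyAcyclicHomExact (A : ModuleCat.{u} R) : Prop :=
  ∀ (X : ℤ → ModuleCat.{u} R) (d : ∀ i : ℤ, X i ⟶ X (i + 1)) (w : ∀ i, d i ≫ d (i + 1) = 0),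
    (∀ i, Projective (X i)) →
    (∀ i, (ShortComplex.mk (d i) (d (i + 1)) (w i)).Exact) →
    (∀ F, Projective F → ∀ (i : ℤ) (f : X (i + 1) ⟶ F), d i ≫ f = 0 →
      ∃ g : X (i + 1 + 1) ⟶ F, d (i + 1) ≫ g = f) →
    ∀ (i : ℤ) (f : X (i + 1) ⟶ A), d i ≫ f = 0 → ∃ g : X (i + 1 + 1) ⟶ A, d (i + 1) ≫ g = f

lemma isTotallyAcyclicHomExact_of_ext [HasExt.{w} (ModuleCat.{u} R)] {A : ModuleCat.{u} R}
    (hA : ∀ G : ModuleCat.{u} R, IsGorensteinProjective R G → Subsingleton (Abelian.Ext G A 1)) :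
    IsTotallyAcyclicHomExact R A := by
  intro X d w hX hE hQ i f hf
  obtain ⟨_, h₀⟩ := shortExact_image (hE i)
  obtain ⟨_, h₁⟩ := shortExact_image (hE (i + 1))
  have := h₀.epi_g
  let f' : image (d (i + 1)) ⟶ A := h₀.exact.desc f (by
    rw [← cancel_epi (factorThruImage (d i))]
    simpa using hf)
  have hf' : factorThruImage (d (i + 1)) ≫ f' = f := h₀.exact.g_desc _ _
  obtain ⟨g, hg⟩ := exists_extension_of_subsingleton_ext h₁
    (hA _ (isTotallyAcyclicImageFor_image w hX hE hQ _)) f'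
  refine ⟨g, ?_⟩
  rw [← hf', ← hg]
  simp

lemma IsTotallyAcyclicHomExact.of_shortExact {K Q A : ModuleCat.{u} R} {k : K ⟶ Q} {π : Q ⟶ A}
    {w : k ≫ π = 0} (hA : IsTotallyAcyclicHomExact R A) (hQ : Projective Q)
    (hS : (ShortComplex.mk k π w).ShortExact) : IsTotallyAcyclicHomExact R K := by
  intro X d wd hX hE hF i f hf
  have : Mono k := hS.mono_f
  have : Epi π := hS.epi_g
  obtain ⟨h, hh⟩ := hF Q hQ i (f ≫ k) (by rw [reassoc_of% hf, zero_comp])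
  obtain ⟨l, hl⟩ := hA X d wd hX hE hF (i + 1) (h ≫ π) (by rw [reassoc_of% hh, w, comp_zero])
  have := hX (i + 1 + 1 + 1)
  let l' := Projective.factorThru l π
  have hl' : l' ≫ π = l := Projective.factorThru_comp _ _
  refine ⟨hS.exact.lift (h - d (i + 1 + 1) ≫ l') (by simp [hl', hl]), ?_⟩
  rw [← cancel_mono k, Category.assoc, show hS.exact.lift _ _ ≫ k = _ from hS.exact.lift_f _ _]
  simp [hh, reassoc_of% (wd (i + 1))]

/-- A morphism from a Gorenstein projective module to a `Hom`-acyclic module factors through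
a projective module containing the source. -/
lemma IsTotallyAcyclicHomExact.exists_factorization {A G : ModuleCat.{u} R}
    (hA : IsTotallyAcyclicHomExact R A) (hG : IsGorensteinProjective R G) (f : G ⟶ A) :
    ∃ (P : ModuleCat.{u} R) (e : G ⟶ P) (r : P ⟶ A), Projective P ∧ e ≫ r = f := by
  obtain ⟨X, d, w, hX, hE, hQ, ⟨φ⟩⟩ := hG
  have h0 : d (-1) ≫ factorThruImage (d 0) = 0 := by
    rw [← cancel_mono (Limits.image.ι (d 0)), Category.assoc, Limits.image.fac, zero_comp]
    exact w (-1)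
  obtain ⟨g, hg⟩ := hA X d w hX hE hQ (-1) (factorThruImage (d 0) ≫ φ.inv ≫ f)
    (by rw [reassoc_of% h0, zero_comp])
  refine ⟨X (0 + 1), φ.hom ≫ Limits.image.ι (d 0), g, hX _, ?_⟩
  have hg' : Limits.image.ι (d 0) ≫ g = φ.inv ≫ f := by
    rw [← cancel_epi (factorThruImage (d 0)), ← Category.assoc, Limits.image.fac]
    exact hg
  rw [Category.assoc, hg', φ.hom_inv_id_assoc]

/-- If `A` is `Hom`-acyclic and a stable retract of a module with a Gorenstein projective
resolution of length `n`, then `A` has a projective resolution of length `n`. -/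
lemma IsTotallyAcyclicHomExact.exists_projective_res (n : ℕ) :
    ∀ {A M K P : ModuleCat.{u} R}, IsTotallyAcyclicHomExact R A →
      IsGorensteinProjective R K → Res (IsGorensteinProjective R) n K M → Projective P →
      ∀ (i : A ⟶ M) (p : M ⟶ A) (j : A ⟶ P) (q : P ⟶ A), i ≫ p + j ≫ q = 𝟙 A →
      ∃ K', Projective K' ∧ Res (fun P : ModuleCat.{u} R => Projective P) n K' A := by
  induction n with
  | zero =>
    rintro A M K P hA hK ⟨φ⟩ hP i p j q hid
    obtain ⟨P₀, e, r, hP₀, her⟩ := hA.exists_factorization hK (φ.hom ≫ p)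
    have ρ : Retract A (P₀ ⊞ P) :=
      { i := biprod.lift (i ≫ φ.inv ≫ e) j
        r := biprod.desc r q
        retract := by simpa [her] using hid }
    exact ⟨A, ρ.projective, ⟨Iso.refl A⟩⟩
  | succ n ih =>
    rintro A M K P hA hK ⟨B, G, f, g, w, hG, hS, -, hres⟩ hP i p j q hid
    obtain ⟨P₀, e, r, hP₀, her⟩ := hA.exists_factorization hG (g ≫ p)
    obtain ⟨L, Q, k, π, w', hQ, hS', i', p', j', q', hid'⟩ := exists_syzygy hS hid her
    obtain ⟨K', hK', hres'⟩ := ih (hA.of_shortExact hQ hS') hK hres hQ i' p' j' q' hid'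
    exact ⟨K', hK', L, Q, k, π, w', hQ, hS', trivial, hres'⟩

end Modules

end RelHomDim

open RelHomDim in
/-- Theorem 5.6(2). -/
theorem stmt18 (R : Type u) [Ring R] [HasExt.{w} (ModuleCat.{u} R)]
    (A : ModuleCat.{u} R)
    (hA : ∀ G : ModuleCat.{u} R, IsGorensteinProjective R G → ∀ i : ℕ, 1 ≤ i →
      Subsingleton (Abelian.Ext G A i)) :
    rdim (fun P : ModuleCat.{u} R => Projective P) A
      = rdim (IsStronglyGorensteinFlat R) A ∧
    rdim (IsStronglyGorensteinFlat R) A = rdim (IsGorensteinProjective R) A := by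
  have hproj_le : rdim (fun P : ModuleCat.{u} R => Projective P) A
      ≤ rdim (IsGorensteinProjective R) A :=
    rdim_le_rdim fun n K hK hres =>
      (isTotallyAcyclicHomExact_of_ext fun G hG => hA G hG 1 le_rfl).exists_projective_res n
        hK hres (P := 0) inferInstance (𝟙 A) (𝟙 A) 0 0 (by simp)
  have hgor_le : rdim (IsGorensteinProjective R) A ≤ rdim (IsStronglyGorensteinFlat R) A :=
    rdim_anti (fun _ h => h.isGorensteinProjective) A
  have hflat_le : rdim (IsStronglyGorensteinFlat R) A
      ≤ rdim (fun P : ModuleCat.{u} R => Projective P) A :=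
    rdim_anti (fun _ h => isTotallyAcyclicImageFor_of_projective _ h) A
  exact ⟨le_antisymm (hproj_le.trans hgor_le) hflat_le,
    le_antisymm (hflat_le.trans hproj_le) hgor_le⟩
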